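/- arXiv:2408.09704 — 3 statements merged into one kernel-verified Lean document; each statement's English description precedes it below -/
import Mathlib

section
/- Let n ≥ 1 be a natural number, let V be a real inner product space, let f > 0 be a real number, and let v, w ∈ V with ‖v‖ < 1. If d = (n/(n+1))·log f − (1/(2n))·‖w‖² − ⟪w, v⟫, then d ≤ n·(f^{1/(n+1)} − √(1 − ‖v‖²)). -/
open scoped RealInnerProductSpace

theorem stmt_0 (n : ℕ) (hn : 1 ≤ n) {V : Type*} [NormedAddCommGroup V]
    [InnerProductSpace ℝ V] (f : ℝ) (hf : 0 < f) (v w : V) (hv : ‖v‖ < 1)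
    (d : ℝ)
    (hd : d = (n / (n + 1)) * Real.log f - (1 / (2 * n)) * ‖w‖ ^ 2 - ⟪w, v⟫) :
    d ≤ n * (f ^ ((1 : ℝ) / (n + 1)) - Real.sqrt (1 - ‖v‖ ^ 2)) := by
  have hn' : (0 : ℝ) < n := by exact_mod_cast hn
  have hlog : (n / (n + 1)) * Real.log f ≤ n * (f ^ ((1 : ℝ) / (n + 1)) - 1) := by
    have h := Real.log_le_sub_one_of_pos (Real.rpow_pos_of_pos hf ((1 : ℝ) / (n + 1)))
    rw [Real.log_rpow hf] at h
    calc (n / (n + 1)) * Real.log f = n * (1 / (n + 1) * Real.log f) := by ring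
      _ ≤ _ := mul_le_mul_of_nonneg_left h hn'.le
  have hsqrt : Real.sqrt (1 - ‖v‖ ^ 2) ≤ 1 - ‖v‖ ^ 2 / 2 :=
    Real.sqrt_le_iff.2 ⟨by nlinarith [norm_nonneg v], by nlinarith [sq_nonneg (‖v‖ ^ 2)]⟩
  have hyoung : -(1 / (2 * n)) * ‖w‖ ^ 2 - ⟪w, v⟫ ≤ n * (‖v‖ ^ 2 / 2) := by
    have h : 0 ≤ 1 / (2 * (n : ℝ)) * ‖w + (n : ℝ) • v‖ ^ 2 := by positivity
    rw [norm_add_sq_real, inner_smul_right, norm_smul, Real.norm_of_nonneg hn'.le] at h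
    have e : 1 / (2 * (n : ℝ)) * (‖w‖ ^ 2 + 2 * (n * ⟪w, v⟫) + (n * ‖v‖) ^ 2) =
        1 / (2 * n) * ‖w‖ ^ 2 + ⟪w, v⟫ + n * (‖v‖ ^ 2 / 2) := by
      field_simp
    linarith
  have hmul := mul_le_mul_of_nonneg_left hsqrt hn'.le
  linarith
end

section
/- Let n ≥ 1, let A be a symmetric n×n real matrix, and let s > 0 be such that the matrix 1 + s·A is positive definite. Then n + s·(trace A) > 0 and trace((1 + s·A)⁻¹ · A) ≤ (trace A)/(1 + (s/n)·(trace A)). -/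
theorem Matrix.PosDef.sq_card_le_trace_inv_mul_trace {m : Type*} [Fintype m] [DecidableEq m]
    [Nonempty m] {P : Matrix m m ℝ} (hP : P.PosDef) :
    (Fintype.card m : ℝ) ^ 2 ≤ P⁻¹.trace * P.trace := by
  have hT : 0 < P.trace := hP.trace_pos
  have hdet : IsUnit P.det := (Matrix.isUnit_iff_isUnit_det P).1 hP.isUnit
  have key : ∀ c : ℝ, 0 ≤ P⁻¹.trace - 2 * c * Fintype.card m + c ^ 2 * P.trace := by
    intro c
    have h := (hP.inv.posSemidef.conjTranspose_mul_mul_same (1 - c • P)).trace_nonneg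
    have e : (1 - c • P).conjTranspose * P⁻¹ * (1 - c • P)
        = P⁻¹ - (2 * c) • (1 : Matrix m m ℝ) + c ^ 2 • P := by
      have hPH : P.conjTranspose = P := hP.isHermitian
      simp only [Matrix.conjTranspose_sub, Matrix.conjTranspose_one, Matrix.conjTranspose_smul,
        hPH, star_trivial, sub_mul, mul_sub, one_mul, mul_one, Matrix.smul_mul, Matrix.mul_smul,
        Matrix.mul_nonsing_inv _ hdet, Matrix.nonsing_inv_mul _ hdet]
      module
    rw [e] at h
    simpa [Matrix.trace_add, Matrix.trace_sub, Matrix.trace_smul, Matrix.trace_one] using h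
  have h := mul_nonneg (key (Fintype.card m / P.trace)) hT.le
  field_simp at h
  linarith

theorem stmt_3 (n : ℕ) (hn : 1 ≤ n) (A : Matrix (Fin n) (Fin n) ℝ)
    (hA : A.IsSymm) (s : ℝ) (hs : 0 < s) (hpos : (1 + s • A).PosDef) :
    0 < (n : ℝ) + s * A.trace ∧
      ((1 + s • A)⁻¹ * A).trace ≤ A.trace / (1 + (s / n) * A.trace) := by
  have : Nonempty (Fin n) := ⟨⟨0, hn⟩⟩
  have hn0 : (0 : ℝ) < n := by exact_mod_cast hn
  have hT : (1 + s • A).trace = n + s * A.trace := by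
    simp [Matrix.trace_add, Matrix.trace_smul, Matrix.trace_one]
  have hT0 : 0 < (n : ℝ) + s * A.trace := hT ▸ hpos.trace_pos
  refine ⟨hT0, ?_⟩
  have hdet : IsUnit (1 + s • A).det := (Matrix.isUnit_iff_isUnit_det _).1 hpos.isUnit
  have hsum : (1 + s • A)⁻¹.trace + s * ((1 + s • A)⁻¹ * A).trace = n := by
    have h := congrArg Matrix.trace (Matrix.nonsing_inv_mul _ hdet)
    rw [mul_add, mul_one, Matrix.mul_smul] at h
    simpa [Matrix.trace_add, Matrix.trace_smul, Matrix.trace_one] using h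
  have hsq := hpos.sq_card_le_trace_inv_mul_trace
  rw [hT, Fintype.card_fin, eq_sub_of_add_eq hsum] at hsq
  have hden : 1 + s / n * A.trace = (n + s * A.trace) / n := by field_simp
  rw [hden, le_div_iff₀ (div_pos hT0 hn0), ← mul_div_assoc, div_le_iff₀ hn0]
  refine le_of_mul_le_mul_left ?_ hs
  linarith
end

section
/- Let m, n be natural numbers, let c ∈ ℝ and r > 0 with 1 + s·c > 0 for all s ∈ (0, r). Let P : (0, r) → ℝ be differentiable with P(s) > 0 and P′(s) ≤ P(s)·(m/s + n·c/(1 + s·c)) for all s ∈ (0, r), and suppose lim_{s → 0⁺} s^{−m}·P(s) = 1. Then P(s) ≤ s^m·(1 + s·c)^n for all s ∈ (0, r). -/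
theorem stmt_7 (m n : ℕ) (c : ℝ) (r : ℝ) (hr : 0 < r)
    (hc : ∀ s ∈ Set.Ioo (0 : ℝ) r, 0 < 1 + s * c)
    (P P' : ℝ → ℝ)
    (hderiv : ∀ s ∈ Set.Ioo (0 : ℝ) r, HasDerivAt P (P' s) s)
    (hPpos : ∀ s ∈ Set.Ioo (0 : ℝ) r, 0 < P s)
    (hP' : ∀ s ∈ Set.Ioo (0 : ℝ) r,
      P' s ≤ P s * (m / s + n * c / (1 + s * c)))
    (hlim : Filter.Tendsto (fun s => P s / s ^ m)
      (nhdsWithin 0 (Set.Ioi 0)) (nhds 1)) :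
    ∀ s ∈ Set.Ioo (0 : ℝ) r, P s ≤ s ^ m * (1 + s * c) ^ n := by
  set G : ℝ → ℝ := fun s => Real.log (P s) - m * Real.log s - n * Real.log (1 + s * c)
  have hGderiv : ∀ s ∈ Set.Ioo (0 : ℝ) r,
      HasDerivAt G (P' s / P s - m * s⁻¹ - n * (c / (1 + s * c))) s := by
    intro s hs
    have hlin : HasDerivAt (fun s : ℝ => 1 + s * c) c s := by
      simpa using ((hasDerivAt_id s).mul_const c).const_add 1
    exact (((hderiv s hs).log (hPpos s hs).ne').sub
      ((Real.hasDerivAt_log hs.1.ne').const_mul (m : ℝ))).sub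
      ((hlin.log (hc s hs).ne').const_mul (n : ℝ))
  have hanti : AntitoneOn G (Set.Ioo 0 r) := by
    apply antitoneOn_of_deriv_nonpos (convex_Ioo 0 r)
    · exact fun s hs => (hGderiv s hs).continuousAt.continuousWithinAt
    · rw [interior_Ioo]
      exact fun s hs => (hGderiv s hs).differentiableAt.differentiableWithinAt
    · rw [interior_Ioo]
      intro s hs
      rw [(hGderiv s hs).deriv]
      have hle : P' s / P s ≤ m / s + n * c / (1 + s * c) :=
        (div_le_iff₀' (hPpos s hs)).2 (hP' s hs)
      rw [div_eq_mul_inv (m : ℝ) s, mul_div_assoc] at hle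
      linarith
  have hGlim : Filter.Tendsto G (nhdsWithin 0 (Set.Ioi 0)) (nhds 0) := by
    have hlog : Filter.Tendsto (fun s => Real.log (P s / s ^ m))
        (nhdsWithin 0 (Set.Ioi 0)) (nhds 0) := by
      simpa using hlim.log one_ne_zero
    have hcont : ContinuousAt (fun s : ℝ => n * Real.log (1 + s * c)) 0 := by
      exact continuousAt_const.mul (ContinuousAt.log (by fun_prop) (by simp))
    have hlin : Filter.Tendsto (fun s : ℝ => n * Real.log (1 + s * c))
        (nhdsWithin 0 (Set.Ioi 0)) (nhds 0) := by
      simpa using hcont.tendsto.mono_left nhdsWithin_le_nhds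
    have hsub := hlog.sub hlin
    rw [sub_zero] at hsub
    refine hsub.congr' ?_
    filter_upwards [Ioo_mem_nhdsGT hr] with s hs
    rw [Real.log_div (hPpos s hs).ne' (pow_pos hs.1 m).ne', Real.log_pow]
  intro s hs
  have hGs : G s ≤ 0 := by
    refine ge_of_tendsto hGlim ?_
    filter_upwards [Ioo_mem_nhdsGT hs.1] with t ht
    exact hanti ⟨ht.1, ht.2.trans hs.2⟩ hs ht.2.le
  have hspow := pow_pos hs.1 m
  have hcpow := pow_pos (hc s hs) n
  rw [← Real.log_le_log_iff (hPpos s hs) (mul_pos hspow hcpow),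
    Real.log_mul hspow.ne' hcpow.ne', Real.log_pow, Real.log_pow]
  linarith
end
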